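/- arXiv:1603.04836 — 4 statements merged into one kernel-verified Lean document; each statement's English description precedes it below -/
import Mathlib

section
/- If 1 < b ≤ e² (equivalently log b ≤ 2), then for every Δ ∈ [0,1) one has φ(0) ≤ 0, i.e. (1−Δ) log_b(1−Δ) + (1−Δ)Δ/2 ≤ 0; consequently x₀ = 0. -/
/-- `φ(x) = (1−Δ+x) log_b(1−Δ+x) + (1−Δ)(Δ−x)/2`, where `log_b y = log y / log b`
(`Real.logb`), and `0 · log_b 0` is interpreted as `0` (automatic, since `Real.log 0 = 0`). -/
noncomputable def phiFun (b Δ x : ℝ) : ℝ :=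
  (1 - Δ + x) * Real.logb b (1 - Δ + x) + (1 - Δ) * (Δ - x) / 2

/-- `x₀`: the smallest nonnegative solution `x` of `φ(x) ≤ 0`. -/
noncomputable def xZero (b Δ : ℝ) : ℝ := sInf {x : ℝ | 0 ≤ x ∧ phiFun b Δ x ≤ 0}

/-- **(7) Lemma 3.1.** If `1 < b ≤ e²`, then for every `Δ ∈ [0,1)` one has `φ(0) ≤ 0`,
i.e. `(1−Δ) log_b(1−Δ) + (1−Δ)Δ/2 ≤ 0`; consequently `x₀ = 0`. -/
theorem xZero_eq_zero_of_log_le_two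
    (b : ℝ) (hb : 1 < b) (hb2 : b ≤ Real.exp 2) :
    ∀ Δ ∈ Set.Ico (0 : ℝ) 1,
      (1 - Δ) * Real.logb b (1 - Δ) + (1 - Δ) * Δ / 2 ≤ 0 ∧ xZero b Δ = 0 := by
  rintro Δ ⟨hΔ0, hΔ1⟩
  have hlogb_pos : 0 < Real.log b := Real.log_pos hb
  have hlogb_le : Real.log b ≤ 2 := (Real.log_le_iff_le_exp (by linarith)).2 hb2
  have hlog : Real.log (1 - Δ) ≤ -Δ := by
    linarith [Real.log_le_sub_one_of_pos (sub_pos.2 hΔ1)]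
  have hlogb : Real.logb b (1 - Δ) ≤ -Δ / 2 := by
    rw [Real.logb, div_le_iff₀ hlogb_pos]
    nlinarith
  have hle : (1 - Δ) * Real.logb b (1 - Δ) + (1 - Δ) * Δ / 2 ≤ 0 := by
    nlinarith
  refine ⟨hle, IsLeast.csInf_eq ⟨⟨le_rfl, ?_⟩, fun x hx => hx.1⟩⟩
  simpa [phiFun] using hle
end

section
/- If log b > 2, then for every Δ ∈ [0,1) the smallest nonnegative solution x₀ of φ(x) ≤ 0 satisfies 0 ≤ x₀ ≤ 1 − 2/log b. -/
/-- `xZero b Δ` is at most any nonnegative solution of `φ(x) ≤ 0`. -/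
theorem xZero_le {b Δ x : ℝ} (hx : 0 ≤ x) (hφ : phiFun b Δ x ≤ 0) : xZero b Δ ≤ x :=
  csInf_le ⟨0, fun _ h => h.1⟩ ⟨hx, hφ⟩

theorem xZero_nonneg (b Δ : ℝ) : 0 ≤ xZero b Δ :=
  Real.sInf_nonneg fun _ h => h.1

theorem phiFun_self (b Δ : ℝ) : phiFun b Δ Δ = 0 := by
  simp [phiFun]

/-- The estimate `log y ≤ y - 1`, applied to `φ`. -/
theorem log_mul_phiFun_le {b Δ x : ℝ} (hb : 0 < Real.log b) (hy : 0 < 1 - Δ + x) :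
    Real.log b * phiFun b Δ x ≤
      (Δ - x) * ((1 - Δ) * Real.log b / 2 - (1 - Δ + x)) := by
  have hlog := mul_le_mul_of_nonneg_left (Real.log_le_sub_one_of_pos hy) hy.le
  have hφ : Real.log b * phiFun b Δ x =
      (1 - Δ + x) * Real.log (1 - Δ + x) + (1 - Δ) * Real.log b / 2 * (Δ - x) := by
    rw [phiFun, Real.logb]
    field_simp
  rw [hφ]
  linarith

theorem phiFun_one_sub_two_div_log_nonpos {b Δ : ℝ} (hb : 2 < Real.log b)
    (hΔ : 1 - 2 / Real.log b ≤ Δ) (hΔ' : Δ < 1) :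
    phiFun b Δ (1 - 2 / Real.log b) ≤ 0 := by
  have hL : 0 < Real.log b := by linarith
  have ht : 2 / Real.log b < 1 := (div_lt_one hL).2 hb
  have hbound := log_mul_phiFun_le (x := 1 - 2 / Real.log b) hL
    (add_pos (sub_pos.2 hΔ') (sub_pos.2 ht))
  have hfactor : (1 - Δ) * Real.log b / 2 - (1 - Δ + (1 - 2 / Real.log b)) =
      (Real.log b / 2 - 1) * ((1 - 2 / Real.log b) - Δ) := by
    field_simp
    ring
  rw [hfactor] at hbound
  refine nonpos_of_mul_nonpos_right (hbound.trans ?_) hL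
  have hk : 0 ≤ Real.log b / 2 - 1 := by linarith
  exact mul_nonpos_of_nonneg_of_nonpos (sub_nonneg.2 hΔ)
    (mul_nonpos_of_nonneg_of_nonpos hk (sub_nonpos.2 hΔ))

/-- **(8) Lemma 3.2.** If `log b > 2`, then for every `Δ ∈ [0,1)` the smallest nonnegative
solution `x₀` of `φ(x) ≤ 0` satisfies `0 ≤ x₀ ≤ 1 − 2/log b`. -/
theorem xZero_bounds_of_log_gt_two
    (b : ℝ) (hb : 2 < Real.log b) :
    ∀ Δ ∈ Set.Ico (0 : ℝ) 1,
      0 ≤ xZero b Δ ∧ xZero b Δ ≤ 1 - 2 / Real.log b := by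
  rintro Δ ⟨hΔ, hΔ'⟩
  refine ⟨xZero_nonneg b Δ, ?_⟩
  rcases le_total Δ (1 - 2 / Real.log b) with h | h
  · exact (xZero_le hΔ (phiFun_self b Δ).le).trans h
  · exact xZero_le (sub_nonneg.2 ((div_lt_one (by linarith)).2 hb).le)
      (phiFun_one_sub_two_div_log_nonpos hb h hΔ')
end

section
/- Suppose log b > 2 and fix ε' > 0. Then there is a constant c₁ > 0, depending only on ε' and b (one may take c₁ = ε'²/(2 log b)), such that for every Δ ∈ [0,1): if x₀ > ε', then φ(x₀ − ε') ≥ c₁. -/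
theorem continuous_phiFun (b Δ : ℝ) : Continuous (phiFun b Δ) := by
  have h : Continuous fun x : ℝ => (1 - Δ + x) * Real.log (1 - Δ + x) :=
    Real.continuous_mul_log.comp (continuous_const.add continuous_id)
  have h' : phiFun b Δ = fun x =>
      (1 - Δ + x) * Real.log (1 - Δ + x) / Real.log b + (1 - Δ) * (Δ - x) / 2 := by
    funext x
    simp only [phiFun, Real.logb]
    ring
  rw [h']
  fun_prop

theorem bddBelow_phiFun_nonpos (b Δ : ℝ) : BddBelow {x : ℝ | 0 ≤ x ∧ phiFun b Δ x ≤ 0} :=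
  ⟨0, fun _ hx => hx.1⟩

theorem xZero_le_s9 (b : ℝ) {Δ : ℝ} (hΔ : 0 ≤ Δ) : xZero b Δ ≤ Δ :=
  csInf_le (bddBelow_phiFun_nonpos b Δ) ⟨hΔ, (phiFun_self b Δ).le⟩

theorem phiFun_xZero_nonpos (b : ℝ) {Δ : ℝ} (hΔ : 0 ≤ Δ) : phiFun b Δ (xZero b Δ) ≤ 0 := by
  have hclosed : IsClosed {x : ℝ | 0 ≤ x ∧ phiFun b Δ x ≤ 0} :=
    (isClosed_le continuous_const continuous_id).inter
      (isClosed_le (continuous_phiFun b Δ) continuous_const)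
  exact (hclosed.csInf_mem ⟨Δ, hΔ, (phiFun_self b Δ).le⟩ (bddBelow_phiFun_nonpos b Δ)).2

theorem phiFun_pos_of_lt_xZero {b Δ x : ℝ} (hx : 0 ≤ x) (hlt : x < xZero b Δ) :
    0 < phiFun b Δ x := by
  by_contra! h
  exact hlt.not_ge (csInf_le (bddBelow_phiFun_nonpos b Δ) ⟨hx, h⟩)

/-- A quantitative midpoint convexity estimate for `y ↦ y log y` on `(0, 1]`. -/
theorem two_mul_mul_log_add_sq_le {m h : ℝ} (hh : 0 ≤ h) (hm : h < m) (h1 : m + h ≤ 1) :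
    2 * (m * Real.log m) + h ^ 2 / 2 ≤
      (m - h) * Real.log (m - h) + (m + h) * Real.log (m + h) := by
  have hm0 : 0 < m := hh.trans_lt hm
  have hu0 : 0 < m - h := sub_pos.2 hm
  have hv0 : 0 < m + h := by positivity
  have hu : -h ≤ (m - h) * (Real.log (m - h) - Real.log m) := by
    rw [← Real.log_div hu0.ne' hm0.ne']
    calc -h = (m - h) * (1 - ((m - h) / m)⁻¹) := by field_simp; ring
      _ ≤ _ := mul_le_mul_of_nonneg_left
        (Real.one_sub_inv_le_log_of_pos (div_pos hu0 hm0)) hu0.le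
  have hv : h + h ^ 2 / 2 ≤ (m + h) * (Real.log (m + h) - Real.log m) := by
    rw [← Real.log_div hv0.ne' hm0.ne', show (m + h) / m = 1 + h / m by field_simp]
    calc h + h ^ 2 / 2 ≤ h + h ^ 2 / (h + 2 * m) := by
          gcongr
          linarith
      _ = (m + h) * (2 * (h / m) / (h / m + 2)) := by field_simp; ring
      _ ≤ _ := mul_le_mul_of_nonneg_left
        (Real.le_log_one_add_of_nonneg (div_nonneg hh hm0.le)) hv0.le
  linarith

theorem two_mul_phiFun_add_le {b Δ x h : ℝ} (hb : 0 < Real.log b) (hh : 0 ≤ h)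
    (hx : h < 1 - Δ + x) (h1 : x + h ≤ Δ) :
    2 * phiFun b Δ x + h ^ 2 / (2 * Real.log b) ≤
      phiFun b Δ (x - h) + phiFun b Δ (x + h) := by
  have key := div_le_div_of_nonneg_right
    (two_mul_mul_log_add_sq_le (m := 1 - Δ + x) hh hx (by linarith)) hb.le
  simp only [phiFun, Real.logb, ← add_sub_assoc, ← add_assoc] at key ⊢
  linear_combination key

/-- **(9) Lemma 3.3.** Suppose `log b > 2` and fix `ε' > 0`.  Then there is a constant
`c₁ > 0`, depending only on `ε'` and `b`, such that for every `Δ ∈ [0,1)`: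
if `x₀ > ε'`, then `φ(x₀ − ε') ≥ c₁`. -/
theorem phi_lower_bound_left_of_xZero
    (b : ℝ) (hb : 2 < Real.log b) (ε' : ℝ) (hε' : 0 < ε') :
    ∃ c₁ > (0 : ℝ), ∀ Δ ∈ Set.Ico (0 : ℝ) 1,
      ε' < xZero b Δ → c₁ ≤ phiFun b Δ (xZero b Δ - ε') := by
  refine ⟨(ε' / 2) ^ 2 / (2 * Real.log b), by positivity, fun Δ hΔ hlt => ?_⟩
  have hle := xZero_le_s9 b hΔ.1
  have hpos : 0 < phiFun b Δ (xZero b Δ - ε' / 2) :=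
    phiFun_pos_of_lt_xZero (by linarith) (by linarith)
  have hzero := phiFun_xZero_nonpos b hΔ.1
  have hmid := two_mul_phiFun_add_le (b := b) (Δ := Δ) (x := xZero b Δ - ε' / 2) (h := ε' / 2)
    (by linarith) (by linarith) (by linarith [hΔ.2]) (by linarith)
  rw [sub_add_cancel, sub_sub, add_halves] at hmid
  linarith
end

section
/- Fix ε ∈ (0,1) and set c₂ = −(1−ε) log(1−ε)/ε, which lies in (0,1). Then for every real b > 1 and every Δ ∈ [0,1): if x₀ ≤ Δ − ε, then 1 − Δ ≤ 2c₂/log b. -/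
theorem xZero_mem {b Δ : ℝ} (hΔ : 0 ≤ Δ) :
    0 ≤ xZero b Δ ∧ phiFun b Δ (xZero b Δ) ≤ 0 := by
  have hclosed : IsClosed {x : ℝ | 0 ≤ x ∧ phiFun b Δ x ≤ 0} :=
    (isClosed_le continuous_const continuous_id).inter
      (isClosed_le (continuous_phiFun b Δ) continuous_const)
  exact hclosed.csInf_mem ⟨Δ, hΔ, (phiFun_self b Δ).le⟩ ⟨0, fun _ hx => hx.1⟩

/-- The function `y ↦ -y log y / (1 - y)` is monotone on `[0, 1)`. -/
theorem neg_mul_log_div_one_sub_mono {y z : ℝ} (hy : 0 ≤ y) (hyz : y ≤ z) (hz : z < 1) :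
    -y * Real.log y / (1 - y) ≤ -z * Real.log z / (1 - z) := by
  have h := Real.convexOn_mul_log.secant_mono (a := 1) (x := y) (y := z)
    (by simp) hy (hy.trans hyz) (by linarith) hz.ne hyz
  simp only [Real.log_one, mul_zero, sub_zero] at h
  rw [← neg_sub y 1, ← neg_sub z 1, neg_mul, neg_mul, neg_div_neg_eq, neg_div_neg_eq]
  exact h

theorem neg_one_sub_mul_log_div_mem_Ioo {ε : ℝ} (hε : ε ∈ Set.Ioo (0 : ℝ) 1) :
    -(1 - ε) * Real.log (1 - ε) / ε ∈ Set.Ioo (0 : ℝ) 1 := by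
  obtain ⟨h0, h1⟩ := hε
  have hpos : 0 < 1 - ε := by linarith
  constructor
  · have hlog := Real.log_neg hpos (by linarith)
    exact div_pos (mul_pos_of_neg_of_neg (by linarith) hlog) h0
  · have hlog := Real.log_lt_sub_one_of_pos (inv_pos.2 hpos)
      (inv_ne_one.2 (by linarith))
    rw [Real.log_inv] at hlog
    have h := mul_lt_mul_of_pos_left hlog hpos
    rw [mul_sub, mul_inv_cancel₀ hpos.ne'] at h
    rw [div_lt_one h0]
    linarith

/-- **(10) Lemma 3.4.** Fix `ε ∈ (0,1)` and set `c₂ = −(1−ε) log(1−ε)/ε`, which lies in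
`(0,1)`.  Then for every real `b > 1` and every `Δ ∈ [0,1)`: if `x₀ ≤ Δ − ε`, then
`1 − Δ ≤ 2c₂/log b`. -/
theorem one_sub_Delta_le_of_xZero_le
    (ε : ℝ) (hε : ε ∈ Set.Ioo (0 : ℝ) 1) :
    -(1 - ε) * Real.log (1 - ε) / ε ∈ Set.Ioo (0 : ℝ) 1 ∧
    ∀ b : ℝ, 1 < b → ∀ Δ ∈ Set.Ico (0 : ℝ) 1,
      xZero b Δ ≤ Δ - ε →
        1 - Δ ≤ 2 * (-(1 - ε) * Real.log (1 - ε) / ε) / Real.log b := by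
  refine ⟨neg_one_sub_mul_log_div_mem_Ioo hε, fun b hb Δ hΔ hx => ?_⟩
  obtain ⟨hx0, hφ⟩ := xZero_mem (b := b) hΔ.1
  generalize xZero b Δ = x at hx hx0 hφ
  have hL : 0 < Real.log b := Real.log_pos hb
  have hε0 := hε.1
  have hΔ1 := hΔ.2
  have hmono := neg_mul_log_div_one_sub_mono (y := 1 - Δ + x) (z := 1 - ε)
    (by linarith) (by linarith) (by linarith)
  rw [sub_sub_cancel, show 1 - (1 - Δ + x) = Δ - x by ring] at hmono
  have hd : 0 < Δ - x := by linarith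
  rw [phiFun, Real.logb, ← mul_div_assoc] at hφ
  calc 1 - Δ ≤ 2 * (-(1 - Δ + x) * Real.log (1 - Δ + x) / (Δ - x)) / Real.log b := by
        rw [← mul_div_assoc, div_right_comm, le_div_iff₀ hd]
        have : 2 * (-(1 - Δ + x) * Real.log (1 - Δ + x)) / Real.log b =
            -2 * ((1 - Δ + x) * Real.log (1 - Δ + x) / Real.log b) := by ring
        linarith
    _ ≤ _ := by gcongr
end
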